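/- arXiv:2204.00032 — 6 statements merged into one kernel-verified Lean document; each statement's English description precedes it below -/
import Mathlib

section
/- Let E be a real inner product space and let D be a labeled dataset in E containing a protruding point (x_t, false) and containing at least one other labeled point besides (x_t, false). Then there exist a point x_p ∈ E and a real number m > 0 such that, writing D' = D ∪ {(x_p, true)} and D'' = (D \ {(x_t, false)}) ∪ {(x_p, true)}: (i) some pair (w, b) linearly separates D' with margin equal to m and with the distance from x_t to the hyperplane {z : ⟪w, z⟫ + b = 0} equal to m; (ii) every pair linearly separating D' has margin at most m; (iii) every pair (w, b) linearly separating D' with margin equal to m has the distance from x_t to its hyperplane equal to m (i.e., (x_t, false) is a support vector of every maximum-margin separator of D'); and (iv) some pair linearly separates D'' with margin at least 2m, which is strictly larger than m. -/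
open RealInnerProductSpace

variable {E : Type*} [NormedAddCommGroup E] [InnerProductSpace ℝ E] [DecidableEq E]

/-- A pair `(w, b)` with `w ≠ 0` linearly separates the labeled dataset `D` if
`⟪w, x⟫ + b > 0` for every positive point and `⟪w, x⟫ + b < 0` for every negative point. -/
def Separates (w : E) (b : ℝ) (D : Finset (E × Bool)) : Prop :=
  (∀ p ∈ D, p.2 = true → 0 < ⟪w, p.1⟫ + b) ∧
  (∀ p ∈ D, p.2 = false → ⟪w, p.1⟫ + b < 0)

/-- The margin of the pair `(w, b)` on a (nonempty) dataset `D`: the minimum over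
`(x, c) ∈ D` of the distance `|⟪w, x⟫ + b| / ‖w‖` from `x` to the hyperplane. -/
noncomputable def margin (w : E) (b : ℝ) (D : Finset (E × Bool)) : ℝ :=
  sInf ((fun p : E × Bool => |⟪w, p.1⟫ + b| / ‖w‖) '' (D : Set (E × Bool)))

/-- `(x_t, c_t)` is protruding in `D` if some direction `w` linearly separates both `D`
and the dataset obtained by flipping the label of `x_t` (with possibly different offsets). -/
def Protruding (D : Finset (E × Bool)) (xt : E) (ct : Bool) : Prop :=
  ∃ w : E, w ≠ 0 ∧ ∃ b₀ b₁ : ℝ,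
    Separates w b₀ D ∧ Separates w b₁ (D.erase (xt, ct) ∪ {(xt, !ct)})

theorem margin_le (w : E) (b : ℝ) {D : Finset (E × Bool)} {p : E × Bool} (hp : p ∈ D) :
    margin w b D ≤ |⟪w, p.1⟫ + b| / ‖w‖ := by
  refine csInf_le ⟨0, ?_⟩ ⟨p, hp, rfl⟩
  rintro _ ⟨q, -, rfl⟩
  positivity

theorem le_margin {w : E} {b r : ℝ} {D : Finset (E × Bool)} (hD : D.Nonempty)
    (h : ∀ p ∈ D, r ≤ |⟪w, p.1⟫ + b| / ‖w‖) : r ≤ margin w b D := by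
  refine le_csInf (Set.Nonempty.image _ hD) ?_
  rintro _ ⟨q, hq, rfl⟩
  exact h q hq

/-- The distances of two oppositely labeled points to a separating hyperplane add up to at most
the distance between the points. -/
theorem Separates.add_dist_le {w : E} {b : ℝ} {D : Finset (E × Bool)} (hw : w ≠ 0)
    (h : Separates w b D) {x y : E} (hx : (x, false) ∈ D) (hy : (y, true) ∈ D) :
    |⟪w, x⟫ + b| / ‖w‖ + |⟪w, y⟫ + b| / ‖w‖ ≤ ‖y - x‖ := by
  have hx' := h.2 _ hx rfl
  have hy' := h.1 _ hy rfl
  have hin := real_inner_le_norm w (y - x)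
  rw [inner_sub_right] at hin
  rw [abs_of_neg hx', abs_of_pos hy', ← add_div, div_le_iff₀ (norm_pos_iff.2 hw)]
  linarith

/-- Around a protruding negative point, some unit direction `u` leaves a gap of positive
width on both sides: positives lie above the point and the other negatives below. -/
theorem Protruding.exists_gap {D : Finset (E × Bool)} {xt : E} (hmem : (xt, false) ∈ D)
    (hprot : Protruding D xt false) (hother : ∃ p ∈ D, p ≠ (xt, false)) :
    ∃ (u : E) (m : ℝ), ‖u‖ = 1 ∧ 0 < m ∧
      (∀ x, (x, true) ∈ D → 2 * m ≤ ⟪u, x⟫ - ⟪u, xt⟫) ∧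
      (∀ x, (x, false) ∈ D → x ≠ xt → ⟪u, x⟫ - ⟪u, xt⟫ ≤ -(2 * m)) := by
  obtain ⟨w, hw, b₀, b₁, h₀, h₁⟩ := hprot
  have hn : 0 < ‖w‖⁻¹ := inv_pos.2 (norm_pos_iff.2 hw)
  set u : E := ‖w‖⁻¹ • w with hu
  have hinner (x : E) : ⟪u, x⟫ - ⟪u, xt⟫ = ‖w‖⁻¹ * (⟪w, x⟫ - ⟪w, xt⟫) := by
    rw [hu, real_inner_smul_left, real_inner_smul_left, mul_sub]
  have hpos (x : E) (hx : (x, true) ∈ D) : 0 < ⟪u, x⟫ - ⟪u, xt⟫ := by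
    have hx' := h₀.1 _ hx rfl
    have ht := h₀.2 _ hmem rfl
    rw [hinner]
    exact mul_pos hn (by simp only at hx' ht; linarith)
  have hneg (x : E) (hx : (x, false) ∈ D) (hne : x ≠ xt) : ⟪u, x⟫ - ⟪u, xt⟫ < 0 := by
    have hx' := h₁.2 (x, false) (by simp [hx, hne]) rfl
    have ht := h₁.1 (xt, true) (by simp) rfl
    rw [hinner]
    exact mul_neg_of_pos_of_neg hn (by simp only at hx' ht; linarith)
  obtain ⟨p, hp, hpne⟩ := hother
  obtain ⟨q, hq, hmin⟩ := (D.erase (xt, false)).exists_min_image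
    (fun p => |⟪u, p.1⟫ - ⟪u, xt⟫|) ⟨p, Finset.mem_erase.2 ⟨hpne, hp⟩⟩
  refine ⟨u, |⟪u, q.1⟫ - ⟪u, xt⟫| / 2, ?_, ?_, fun x hx => ?_, fun x hx hne => ?_⟩
  · rw [hu, norm_smul, norm_inv, norm_norm, inv_mul_cancel₀ (norm_ne_zero_iff.2 hw)]
  · obtain ⟨x, c⟩ := q
    refine half_pos (abs_pos.2 ?_)
    cases c with
    | true => exact (hpos x (Finset.mem_of_mem_erase hq)).ne'
    | false =>
      refine (hneg x (Finset.mem_of_mem_erase hq) ?_).ne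
      rintro rfl
      simp at hq
  · have h := hmin (x, true) (by simp [hx])
    simp only [abs_of_pos (hpos x hx)] at h
    linarith
  · have h := hmin (x, false) (by simp [hx, hne])
    simp only [abs_of_neg (hneg x hx hne)] at h
    linarith

/-- A unit direction with all positives at height at least `r` and all negatives at height at
most `-r` separates with margin at least `r`. -/
theorem separates_and_le_margin {u : E} {b r : ℝ} {D : Finset (E × Bool)} (hu : ‖u‖ = 1)
    (hr : 0 < r) (hD : D.Nonempty) (hpos : ∀ x, (x, true) ∈ D → r ≤ ⟪u, x⟫ + b)
    (hneg : ∀ x, (x, false) ∈ D → ⟪u, x⟫ + b ≤ -r) :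
    Separates u b D ∧ r ≤ margin u b D := by
  refine ⟨⟨?_, ?_⟩, le_margin hD ?_⟩
  · rintro ⟨x, _⟩ hx rfl
    exact hr.trans_le (hpos x hx)
  · rintro ⟨x, _⟩ hx rfl
    exact (hneg x hx).trans_lt (neg_neg_of_pos hr)
  · rintro ⟨x, c⟩ hx
    rw [hu, div_one]
    cases c with
    | true => exact (hpos x hx).trans (le_abs_self _)
    | false => exact (le_neg_of_le_neg (hneg x hx)).trans (neg_le_abs _)

/-- Poisoning a protruding point: there is a poison point `x_p` and a margin value `m > 0`
such that (i) some separator of `D ∪ {(x_p, true)}` has margin `m` with `x_t` at distance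
exactly `m` from its hyperplane; (ii) every separator of the poisoned dataset has margin at
most `m`; (iii) every maximum-margin separator of the poisoned dataset has `x_t` at distance
exactly `m` (so `(x_t, false)` is a support vector); and (iv) when `(x_t, false)` is removed,
some separator achieves margin at least `2m > m`. -/
theorem poisoning_forces_support_vector
    (D : Finset (E × Bool)) (xt : E)
    (hmem : (xt, false) ∈ D)
    (hprot : Protruding D xt false)
    (hother : ∃ p ∈ D, p ≠ (xt, false)) :
    ∃ (xp : E) (m : ℝ), 0 < m ∧
      (∃ w : E, ∃ b : ℝ, w ≠ 0 ∧ Separates w b (D ∪ {(xp, true)}) ∧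
        margin w b (D ∪ {(xp, true)}) = m ∧ |⟪w, xt⟫ + b| / ‖w‖ = m) ∧
      (∀ w : E, ∀ b : ℝ, w ≠ 0 → Separates w b (D ∪ {(xp, true)}) →
        margin w b (D ∪ {(xp, true)}) ≤ m) ∧
      (∀ w : E, ∀ b : ℝ, w ≠ 0 → Separates w b (D ∪ {(xp, true)}) →
        margin w b (D ∪ {(xp, true)}) = m → |⟪w, xt⟫ + b| / ‖w‖ = m) ∧
      (∃ w : E, ∃ b : ℝ, w ≠ 0 ∧
        Separates w b (D.erase (xt, false) ∪ {(xp, true)}) ∧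
        2 * m ≤ margin w b (D.erase (xt, false) ∪ {(xp, true)}) ∧
        m < margin w b (D.erase (xt, false) ∪ {(xp, true)})) := by
  obtain ⟨u, m, hu, hm, hpos, hneg⟩ := hprot.exists_gap hmem hother
  have hu0 : u ≠ 0 := norm_ne_zero_iff.1 (by rw [hu]; exact one_ne_zero)
  set xp : E := xt + (2 * m) • u with hxp
  have hxp_inner : ⟪u, xp⟫ = ⟪u, xt⟫ + 2 * m := by
    rw [hxp, inner_add_right, real_inner_smul_right, real_inner_self_eq_norm_sq, hu]
    ring
  have hdist : ‖xp - xt‖ = 2 * m := by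
    rw [hxp, add_sub_cancel_left, norm_smul, hu, mul_one, Real.norm_of_nonneg (by positivity)]
  have hxt_mem : (xt, false) ∈ D ∪ {(xp, true)} := Finset.mem_union_left _ hmem
  have hxp_mem : (xp, true) ∈ D ∪ {(xp, true)} := by simp
  have key (w : E) (b : ℝ) (hw : w ≠ 0) (hs : Separates w b (D ∪ {(xp, true)})) :
      margin w b (D ∪ {(xp, true)}) ≤ |⟪w, xt⟫ + b| / ‖w‖ ∧
        |⟪w, xt⟫ + b| / ‖w‖ + margin w b (D ∪ {(xp, true)}) ≤ 2 * m := by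
    refine ⟨margin_le w b hxt_mem, ?_⟩
    have h₁ := hs.add_dist_le hw hxt_mem hxp_mem
    have h₂ := margin_le w b hxp_mem
    simp only at h₂
    linarith
  refine ⟨xp, m, hm, ?_, fun w b hw hs => ?_, fun w b hw hs heq => ?_, ?_⟩
  · obtain ⟨hs, hle⟩ := separates_and_le_margin (b := -⟪u, xt⟫ - m) hu hm ⟨_, hxt_mem⟩
      (fun x hx => by
        simp only [Finset.mem_union, Finset.mem_singleton, Prod.mk.injEq, and_true] at hx
        rcases hx with hx | rfl
        · linarith [hpos x hx]
        · linarith)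
      (fun x hx => by
        replace hx : (x, false) ∈ D := by simpa using hx
        by_cases hne : x = xt
        · rw [hne]; linarith
        · linarith [hneg x hx hne])
    have h := key u _ hu0 hs
    exact ⟨u, _, hu0, hs, by linarith, by linarith⟩
  · linarith [key w b hw hs]
  · linarith [key w b hw hs]
  · obtain ⟨hs, hle⟩ := separates_and_le_margin (r := 2 * m) (b := -⟪u, xt⟫)
      (D := D.erase (xt, false) ∪ {(xp, true)}) hu (by positivity) ⟨(xp, true), by simp⟩
      (fun x hx => by
        simp only [Finset.mem_union, Finset.mem_erase, Finset.mem_singleton, Prod.mk.injEq,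
          and_true] at hx
        rcases hx with hx | rfl
        · linarith [hpos x hx.2]
        · linarith)
      (fun x hx => by
        have hx' : x ≠ xt ∧ (x, false) ∈ D := by simpa using hx
        linarith [hneg x hx'.2 hx'.1])
    exact ⟨u, _, hu0, hs, hle, by linarith⟩
end

section
/- Let E be a real inner product space, let D be a labeled dataset with (x_t, false) ∈ D, and let w ≠ 0 and b₀, b₁ ∈ ℝ be such that (w, b₀) linearly separates D and (w, b₁) linearly separates (D \ {(x_t, false)}) ∪ {(x_t, true)}. Then every (x, c) ∈ D with (x, c) ≠ (x_t, false) satisfies: if c = true then ⟪w, x − x_t⟫ > 0, and if c = false then ⟪w, x − x_t⟫ < 0; in particular ⟪w, x − x_t⟫ ≠ 0. Consequently, if D \ {(x_t, false)} is nonempty, then δ := min over (x, c) ∈ D \ {(x_t, false)} of |⟪w, x − x_t⟫| / ‖w‖ is strictly positive (i.e., the minimum distance from the other data points to the hyperplane through x_t with normal w is strictly positive). -/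
open RealInnerProductSpace

variable {E : Type*} [NormedAddCommGroup E] [InnerProductSpace ℝ E] [DecidableEq E]

/-- If `(w, b₀)` separates `D ∋ (x_t, false)` and `(w, b₁)` separates the dataset with the
label of `x_t` flipped, then every other point `(x, c)` of `D` satisfies
`⟪w, x - x_t⟫ > 0` when `c = true`, `⟪w, x - x_t⟫ < 0` when `c = false` (so in particular
`⟪w, x - x_t⟫ ≠ 0`); hence if `D \ {(x_t, false)}` is nonempty, the minimum distance
`δ = min |⟪w, x - x_t⟫| / ‖w‖` from the other data points to the hyperplane through `x_t`
with normal `w` is strictly positive. -/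
theorem other_points_off_target_hyperplane
    (D : Finset (E × Bool)) (xt : E) (hmem : (xt, false) ∈ D)
    (w : E) (hw : w ≠ 0) (b₀ b₁ : ℝ)
    (h₀ : Separates w b₀ D)
    (h₁ : Separates w b₁ (D.erase (xt, false) ∪ {(xt, true)})) :
    (∀ p ∈ D, p ≠ (xt, false) →
      (p.2 = true → 0 < ⟪w, p.1 - xt⟫) ∧
      (p.2 = false → ⟪w, p.1 - xt⟫ < 0) ∧
      ⟪w, p.1 - xt⟫ ≠ 0) ∧
    ((D.erase (xt, false)).Nonempty →
      0 < sInf ((fun p : E × Bool => |⟪w, p.1 - xt⟫| / ‖w‖) ''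
        ((D.erase (xt, false)) : Set (E × Bool)))) := by
  have key : ∀ p ∈ D, p ≠ (xt, false) →
      (p.2 = true → 0 < ⟪w, p.1 - xt⟫) ∧
      (p.2 = false → ⟪w, p.1 - xt⟫ < 0) ∧
      ⟪w, p.1 - xt⟫ ≠ 0 := by
    intro p hp hne
    have hpos : p.2 = true → 0 < ⟪w, p.1 - xt⟫ := by
      intro hc
      have hx := h₀.1 p hp hc
      have ht := h₀.2 (xt, false) hmem rfl
      rw [inner_sub_right]
      linarith
    have hneg : p.2 = false → ⟪w, p.1 - xt⟫ < 0 := by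
      intro hc
      have hx := h₁.2 p (Finset.mem_union_left _ (Finset.mem_erase.2 ⟨hne, hp⟩)) hc
      have ht := h₁.1 (xt, true) (Finset.mem_union_right _ (Finset.mem_singleton_self _)) rfl
      rw [inner_sub_right]
      linarith
    refine ⟨hpos, hneg, ?_⟩
    cases hc : p.2 with
    | true => exact (hpos hc).ne'
    | false => exact (hneg hc).ne
  refine ⟨key, fun hnonempty => ?_⟩
  obtain ⟨p, hp, hmin⟩ := Set.Nonempty.csInf_mem
    ((Finset.coe_nonempty.2 hnonempty).image (fun p : E × Bool => |⟪w, p.1 - xt⟫| / ‖w‖))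
    ((Finset.finite_toSet _).image _)
  rw [← hmin]
  obtain ⟨hne, hpD⟩ := Finset.mem_erase.1 (Finset.mem_coe.1 hp)
  exact div_pos (abs_pos.2 (key p hpD hne).2.2) (norm_pos_iff.2 hw)
end

section
/- Let E be a real inner product space, let w ∈ E with w ≠ 0, let δ > 0, and let D be a labeled dataset with (x_t, false) ∈ D such that every (x, true) ∈ D satisfies ⟪w, x − x_t⟫ ≥ δ‖w‖ and every (x, false) ∈ D with (x, false) ≠ (x_t, false) satisfies ⟪w, x − x_t⟫ ≤ −δ‖w‖. Set x_p := x_t + (δ / (2‖w‖)) • w and b' := −⟪w, x_t⟫ − (δ/4)‖w‖. Then (w, b') linearly separates D ∪ {(x_p, true)}; the distances from x_t and from x_p to the hyperplane {z : ⟪w, z⟫ + b' = 0} are both exactly δ/4; every point of D other than (x_t, false) is at distance at least 3δ/4 from this hyperplane; and hence the margin of (w, b') on D ∪ {(x_p, true)} is exactly δ/4. -/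
open RealInnerProductSpace

variable {E : Type*} [NormedAddCommGroup E] [InnerProductSpace ℝ E] [DecidableEq E]

/-- With the poison `x_p = x_t + (δ/(2‖w‖)) w` and offset `b' = -⟪w, x_t⟫ - (δ/4)‖w‖`,
the pair `(w, b')` separates `D ∪ {(x_p, true)}`; `x_t` and `x_p` are both at distance
exactly `δ/4` from its hyperplane; every other point of `D` is at distance at least `3δ/4`;
hence the margin of `(w, b')` on the poisoned dataset is exactly `δ/4`. -/
theorem poisoned_separator_margin
    (w : E) (hw : w ≠ 0) (δ : ℝ) (hδ : 0 < δ)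
    (D : Finset (E × Bool)) (xt : E) (hmem : (xt, false) ∈ D)
    (hpos : ∀ p ∈ D, p.2 = true → δ * ‖w‖ ≤ ⟪w, p.1 - xt⟫)
    (hneg : ∀ p ∈ D, p.2 = false → p ≠ (xt, false) → ⟪w, p.1 - xt⟫ ≤ -(δ * ‖w‖))
    (xp : E) (hxp : xp = xt + (δ / (2 * ‖w‖)) • w)
    (b' : ℝ) (hb' : b' = -⟪w, xt⟫ - (δ / 4) * ‖w‖) :
    Separates w b' (D ∪ {(xp, true)}) ∧
    |⟪w, xt⟫ + b'| / ‖w‖ = δ / 4 ∧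
    |⟪w, xp⟫ + b'| / ‖w‖ = δ / 4 ∧
    (∀ p ∈ D, p ≠ (xt, false) → 3 * δ / 4 ≤ |⟪w, p.1⟫ + b'| / ‖w‖) ∧
    margin w b' (D ∪ {(xp, true)}) = δ / 4 := by
  have hw' : 0 < ‖w‖ := norm_pos_iff.mpr hw
  have hδw : 0 < δ * ‖w‖ := mul_pos hδ hw'
  have offset_t : ⟪w, xt⟫ + b' = -(δ / 4 * ‖w‖) := by rw [hb']; ring
  have offset_p : ⟪w, xp⟫ + b' = δ / 4 * ‖w‖ := by
    rw [hb', hxp, inner_add_right, inner_smul_right, real_inner_self_eq_norm_sq]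
    field_simp
    ring
  have offset_pos : ∀ p ∈ D, p.2 = true → 3 * δ / 4 * ‖w‖ ≤ ⟪w, p.1⟫ + b' := by
    intro p hp hc
    have h := hpos p hp hc
    rw [inner_sub_right] at h
    linarith
  have offset_neg : ∀ p ∈ D, p.2 = false → p ≠ (xt, false) →
      ⟪w, p.1⟫ + b' ≤ -(3 * δ / 4 * ‖w‖) := by
    intro p hp hc hne
    have h := hneg p hp hc hne
    rw [inner_sub_right] at h
    linarith
  have dist_t : |⟪w, xt⟫ + b'| / ‖w‖ = δ / 4 := by
    rw [offset_t, abs_neg, abs_of_pos (by positivity), mul_div_cancel_right₀ _ hw'.ne']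
  have dist_p : |⟪w, xp⟫ + b'| / ‖w‖ = δ / 4 := by
    rw [offset_p, abs_of_pos (by positivity), mul_div_cancel_right₀ _ hw'.ne']
  have dist_other : ∀ p ∈ D, p ≠ (xt, false) → 3 * δ / 4 ≤ |⟪w, p.1⟫ + b'| / ‖w‖ := by
    intro p hp hne
    rw [le_div_iff₀ hw']
    cases hc : p.2 with
    | true => exact (offset_pos p hp hc).trans (le_abs_self _)
    | false => exact le_abs.mpr (Or.inr (le_neg.mpr (offset_neg p hp hc hne)))
  refine ⟨⟨?_, ?_⟩, dist_t, dist_p, dist_other, ?_⟩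
  · intro p hp hc
    rcases Finset.mem_union.mp hp with hp | hp
    · linarith [offset_pos p hp hc]
    · rw [Finset.mem_singleton.mp hp, offset_p]
      positivity
  · intro p hp hc
    rcases Finset.mem_union.mp hp with hp | hp
    · by_cases hne : p = (xt, false)
      · rw [hne, offset_t]
        linarith
      · linarith [offset_neg p hp hc hne]
    · simp [Finset.mem_singleton.mp hp] at hc
  · refine IsLeast.csInf_eq ⟨⟨(xt, false), ?_, dist_t⟩, ?_⟩
    · exact Finset.mem_coe.mpr (Finset.mem_union_left _ hmem)
    · rintro _ ⟨p, hp, rfl⟩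
      rcases Finset.mem_union.mp (Finset.mem_coe.mp hp) with hp | hp
      · by_cases hne : p = (xt, false)
        · rw [hne]
          exact dist_t.ge
        · exact le_trans (by linarith) (dist_other p hp hne)
      · rw [Finset.mem_singleton.mp hp]
        exact dist_p.ge
end

section
/- Let E be a real inner product space, let w ∈ E with w ≠ 0, let δ > 0, and let D be a labeled dataset with (x_t, false) ∈ D such that every (x, true) ∈ D satisfies ⟪w, x − x_t⟫ ≥ δ‖w‖ and every (x, false) ∈ D with (x, false) ≠ (x_t, false) satisfies ⟪w, x − x_t⟫ ≤ −δ‖w‖. Set x_p := x_t + (δ / (2‖w‖)) • w. Then the pair (w, −⟪w, x_t⟫) linearly separates the dataset D'' := (D \ {(x_t, false)}) ∪ {(x_p, true)} (in which the target has been removed), and its margin on D'' is at least δ/2. -/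
open RealInnerProductSpace

variable {E : Type*} [NormedAddCommGroup E] [InnerProductSpace ℝ E] [DecidableEq E]

/-- With the poison `x_p = x_t + (δ/(2‖w‖)) w`, the pair `(w, -⟪w, x_t⟫)` linearly
separates the dataset `D'' = (D \ {(x_t, false)}) ∪ {(x_p, true)}` in which the target is
removed, with margin at least `δ/2`. -/
theorem poisoned_dataset_without_target_margin
    (w : E) (hw : w ≠ 0) (δ : ℝ) (hδ : 0 < δ)
    (D : Finset (E × Bool)) (xt : E) (hmem : (xt, false) ∈ D)
    (hpos : ∀ p ∈ D, p.2 = true → δ * ‖w‖ ≤ ⟪w, p.1 - xt⟫)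
    (hneg : ∀ p ∈ D, p.2 = false → p ≠ (xt, false) → ⟪w, p.1 - xt⟫ ≤ -(δ * ‖w‖))
    (xp : E) (hxp : xp = xt + (δ / (2 * ‖w‖)) • w) :
    Separates w (-⟪w, xt⟫) (D.erase (xt, false) ∪ {(xp, true)}) ∧
    δ / 2 ≤ margin w (-⟪w, xt⟫) (D.erase (xt, false) ∪ {(xp, true)}) := by
  have hw' : 0 < ‖w‖ := norm_pos_iff.mpr hw
  have hδw : 0 < δ * ‖w‖ := mul_pos hδ hw'
  have hp : ⟪w, xp⟫ + -⟪w, xt⟫ = δ * ‖w‖ / 2 := by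
    rw [hxp, inner_add_right, real_inner_smul_right, real_inner_self_eq_norm_sq]
    field_simp
    ring
  simp only [inner_sub_right] at hpos hneg
  have hpos' : ∀ p ∈ D.erase (xt, false) ∪ {(xp, true)}, p.2 = true →
      δ * ‖w‖ / 2 ≤ ⟪w, p.1⟫ + -⟪w, xt⟫ := by
    intro p hmem' hc
    rcases Finset.mem_union.mp hmem' with h | h
    · linarith [hpos p (Finset.mem_of_mem_erase h) hc]
    · rw [Finset.mem_singleton.mp h]
      exact hp.ge
  have hneg' : ∀ p ∈ D.erase (xt, false) ∪ {(xp, true)}, p.2 = false →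
      ⟪w, p.1⟫ + -⟪w, xt⟫ ≤ -(δ * ‖w‖ / 2) := by
    intro p hmem' hc
    rcases Finset.mem_union.mp hmem' with h | h
    · linarith [hneg p (Finset.mem_of_mem_erase h) hc (Finset.ne_of_mem_erase h)]
    · simp [Finset.mem_singleton.mp h] at hc
  refine ⟨⟨fun p h hc => ?_, fun p h hc => ?_⟩, ?_⟩
  · linarith [hpos' p h hc]
  · linarith [hneg' p h hc]
  · refine le_csInf ⟨_, (xp, true), by simp, rfl⟩ ?_
    rintro _ ⟨p, h, rfl⟩
    rw [le_div_iff₀ hw', div_mul_eq_mul_div]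
    cases hc : p.2 with
    | true => exact (hpos' p h hc).trans (le_abs_self _)
    | false => exact (le_neg_of_le_neg (hneg' p h hc)).trans (neg_le_abs _)
end

section
/- Let X be a metric space, L a type of labels with y ≠ y', m ∈ ℕ, and k := 2m + 1. Let x, x' ∈ X with dist(x, x') = δ for some δ > 0, and let D be a labeled multiset over X × L such that dist(x, z) > δ for every (z, ℓ) ∈ D. Define the poison multiset P := (m copies of (x, y)) + (m copies of (x, y')) + {(x', y')}, and let M := D + P + {(x, y)} (the training multiset when the target (x, y) is a member). Then every k-nearest-neighbor multiset N of M at x equals (m + 1 copies of (x, y)) + (m copies of (x, y')); in particular, count_y(N) = m + 1 > count_ℓ(N) for every label ℓ ≠ y, so y is the strict majority label of N and the k-nearest-neighbor classifier outputs the true label y. -/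
open scoped Classical

/-- The number of elements of the labeled multiset `N` carrying the label `ℓ`. -/
noncomputable def labelCount {X L : Type*} (N : Multiset (X × L)) (ℓ : L) : ℕ :=
  Multiset.countP (fun p => p.2 = ℓ) N

/-- `N` is a `k`-nearest-neighbor multiset of `M` at the query point `x`: a sub-multiset
of `M` of cardinality `k` such that every element of `N` is at least as close to `x` as
every element of `M - N`. -/
def IsKNN {X L : Type*} [MetricSpace X] (M : Multiset (X × L)) (x : X) (k : ℕ)
    (N : Multiset (X × L)) : Prop :=
  N ≤ M ∧ Multiset.card N = k ∧ ∀ a ∈ N, ∀ b ∈ M - N, dist x a.1 ≤ dist x b.1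

/-- `ℓ` is the strict majority label of `N`: it occurs strictly more often than every
other label. -/
def StrictMajority {X L : Type*} (N : Multiset (X × L)) (ℓ : L) : Prop :=
  ∀ ℓ' : L, ℓ' ≠ ℓ → labelCount N ℓ' < labelCount N ℓ

/-- If every point of `A` is strictly closer to `x` than every point of `F`, then `A` is the
only nearest-neighbor multiset of `A + F` of cardinality `card A`. -/
theorem IsKNN.eq_of_dist_lt {X L : Type*} [MetricSpace X] {A F N : Multiset (X × L)} {x : X}
    (hN : IsKNN (A + F) x (Multiset.card A) N)
    (hAF : ∀ a ∈ A, ∀ f ∈ F, dist x a.1 < dist x f.1) : N = A := by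
  obtain ⟨hle, hcard, hdist⟩ := hN
  by_cases hAN : A ≤ N
  · exact (Multiset.eq_of_le_of_card_le hAN hcard.le).symm
  · obtain ⟨c, hc⟩ : ∃ c, Multiset.count c N < Multiset.count c A := by
      simpa [Multiset.le_iff_count] using hAN
    have hcA : c ∈ A := Multiset.count_pos.mp (by lia)
    have hcMN : c ∈ A + F - N := by
      rw [← Multiset.count_pos, Multiset.count_sub, Multiset.count_add]
      lia
    refine Multiset.eq_of_le_of_card_le (Multiset.le_iff_count.mpr fun a => ?_) hcard.ge
    by_cases haN : a ∈ N
    · have haF : a ∉ F := fun haF => ((hdist a haN c hcMN).trans_lt (hAF c hcA a haF)).false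
      simpa [Multiset.count_eq_zero_of_notMem haF] using Multiset.le_iff_count.mp hle a
    · simp [Multiset.count_eq_zero_of_notMem haN]

theorem labelCount_add {X L : Type*} (N N' : Multiset (X × L)) (ℓ : L) :
    labelCount (N + N') ℓ = labelCount N ℓ + labelCount N' ℓ :=
  Multiset.countP_add _ _ _

theorem labelCount_replicate {X L : Type*} (n : ℕ) (p : X × L) (ℓ : L) :
    labelCount (Multiset.replicate n p) ℓ = if p.2 = ℓ then n else 0 := by
  induction n with
  | zero => simp [labelCount]
  | succ n ih =>
    simp only [labelCount] at ih ⊢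
    rw [Multiset.replicate_succ, Multiset.countP_cons, ih]
    split_ifs <;> rfl

/-- kNN poisoning, member case: with poison multiset
`P = m · (x, y) + m · (x, y') + {(x', y')}` where `dist x x' = δ > 0` and every point of
`D` is farther than `δ` from `x`, every `(2m+1)`-nearest-neighbor multiset of
`M = D + P + {(x, y)}` at `x` equals `(m+1) · (x, y) + m · (x, y')`; its count of `y` is
`m + 1`, and `y` is the strict majority label, so the kNN classifier outputs `y`. -/
theorem knn_poisoning_member_case
    {X L : Type*} [MetricSpace X] (y y' : L) (hyy' : y ≠ y') (m : ℕ)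
    (x x' : X) (δ : ℝ) (hδ : 0 < δ) (hxx' : dist x x' = δ)
    (D : Multiset (X × L)) (hD : ∀ p ∈ D, δ < dist x p.1)
    (P : Multiset (X × L))
    (hP : P = Multiset.replicate m (x, y) + Multiset.replicate m (x, y') + {(x', y')})
    (M : Multiset (X × L)) (hM : M = D + P + {(x, y)}) :
    ∀ N : Multiset (X × L), IsKNN M x (2 * m + 1) N →
      N = Multiset.replicate (m + 1) (x, y) + Multiset.replicate m (x, y') ∧
      labelCount N y = m + 1 ∧ StrictMajority N y := by
  intro N hN
  have hMA : M = (Multiset.replicate (m + 1) (x, y) + Multiset.replicate m (x, y')) +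
      (D + {(x', y')}) := by
    rw [hM, hP, Multiset.replicate_add, Multiset.replicate_one]
    abel
  have hcard : Multiset.card (Multiset.replicate (m + 1) (x, y) +
      Multiset.replicate m (x, y')) = 2 * m + 1 := by
    simp only [Multiset.card_add, Multiset.card_replicate]
    lia
  rw [hMA, ← hcard] at hN
  have hNA := hN.eq_of_dist_lt fun a ha f hf => by
    have hax : a.1 = x := by
      rcases Multiset.mem_add.mp ha with h | h <;> rw [Multiset.eq_of_mem_replicate h]
    rw [hax, dist_self]
    rcases Multiset.mem_add.mp hf with h | h
    · exact hδ.trans (hD f h)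
    · rw [Multiset.mem_singleton.mp h, hxx']
      exact hδ
  have hy : labelCount N y = m + 1 := by
    rw [hNA, labelCount_add, labelCount_replicate, labelCount_replicate]
    simp [hyy'.symm]
  refine ⟨hNA, hy, fun ℓ hℓ => ?_⟩
  rw [hy, hNA, labelCount_add, labelCount_replicate, labelCount_replicate, if_neg hℓ.symm]
  split_ifs <;> lia
end

section
/- Let X be a metric space, L a type of labels with y ≠ y', m ∈ ℕ, and k := 2m + 1. Let x, x' ∈ X with dist(x, x') = δ for some δ > 0, and let D be a labeled multiset over X × L such that dist(x, z) > δ for every (z, ℓ) ∈ D. Define the poison multiset P := (m copies of (x, y)) + (m copies of (x, y')) + {(x', y')}, and let M := D + P (the training multiset when the target (x, y) is not a member). Then every k-nearest-neighbor multiset N of M at x equals P; in particular, count_{y'}(N) = m + 1 > count_ℓ(N) for every label ℓ ≠ y', so y' is the strict majority label of N and the k-nearest-neighbor classifier outputs the incorrect label y'. -/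
open scoped Classical

/-- If every point of `P` is strictly closer to `x` than every point of `D`, then `P` is the only
`card P`-nearest-neighbor multiset of `D + P` at `x`. -/
theorem IsKNN.eq_of_forall_dist_lt {X L : Type*} [MetricSpace X] {x : X}
    {D P N : Multiset (X × L)} (hDP : ∀ p ∈ P, ∀ d ∈ D, dist x p.1 < dist x d.1)
    (hN : IsKNN (D + P) x (Multiset.card P) N) : N = P := by
  obtain ⟨hle, hcard, hnear⟩ := hN
  by_cases h : ∃ b ∈ D + P - N, b ∈ P
  · obtain ⟨b, hbN, hbP⟩ := h
    refine Multiset.eq_of_le_of_card_le (Multiset.le_iff_count.2 fun a => ?_) hcard.ge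
    by_cases ha : a ∈ N
    · have haD : a ∉ D := fun haD => (hnear a ha b hbN).not_gt (hDP b hbP a haD)
      simpa [Multiset.count_eq_zero_of_notMem haD] using Multiset.le_iff_count.1 hle a
    · simp [Multiset.count_eq_zero_of_notMem ha]
  · push Not at h
    refine (Multiset.eq_of_le_of_card_le (Multiset.le_iff_count.2 fun a => ?_) hcard.le).symm
    by_cases ha : a ∈ P
    · have hcount := Multiset.count_eq_zero_of_notMem fun hb => h a hb ha
      rw [Multiset.count_sub, Multiset.count_add] at hcount
      omega
    · simp [Multiset.count_eq_zero_of_notMem ha]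

/-- The label counts of `m` copies of `(x, y)`, `m` copies of `(x, y')` and one `(x', y')`. -/
theorem labelCount_poison {X L : Type*} (x x' : X) (y y' : L) (m : ℕ) (ℓ : L) :
    labelCount (Multiset.replicate m (x, y) + Multiset.replicate m (x, y') + {(x', y')}) ℓ =
      (if y = ℓ then m else 0) + (if y' = ℓ then m + 1 else 0) := by
  rw [labelCount, Multiset.countP_add, Multiset.countP_add, ← Multiset.coe_replicate,
    ← Multiset.coe_replicate, Multiset.coe_countP, Multiset.coe_countP, List.countP_replicate,
    List.countP_replicate, ← Multiset.cons_zero, Multiset.countP_cons, Multiset.countP_zero]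
  by_cases h : y' = ℓ <;> simp [h, add_assoc]

/-- kNN poisoning, non-member case: with poison multiset
`P = m · (x, y) + m · (x, y') + {(x', y')}` where `dist x x' = δ > 0` and every point of
`D` is farther than `δ` from `x`, every `(2m+1)`-nearest-neighbor multiset of `M = D + P`
at `x` equals `P`; its count of `y'` is `m + 1`, and `y'` is the strict majority label, so
the kNN classifier outputs the incorrect label `y'`. -/
theorem knn_poisoning_nonmember_case
    {X L : Type*} [MetricSpace X] (y y' : L) (hyy' : y ≠ y') (m : ℕ)
    (x x' : X) (δ : ℝ) (hδ : 0 < δ) (hxx' : dist x x' = δ)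
    (D : Multiset (X × L)) (hD : ∀ p ∈ D, δ < dist x p.1)
    (P : Multiset (X × L))
    (hP : P = Multiset.replicate m (x, y) + Multiset.replicate m (x, y') + {(x', y')})
    (M : Multiset (X × L)) (hM : M = D + P) :
    ∀ N : Multiset (X × L), IsKNN M x (2 * m + 1) N →
      N = P ∧ labelCount N y' = m + 1 ∧ StrictMajority N y' := by
  intro N hN
  subst hM
  have hcard : Multiset.card P = 2 * m + 1 := by
    simp [hP, two_mul]
  have hclose : ∀ p ∈ P, dist x p.1 ≤ δ := by
    intro p hp
    simp only [hP, Multiset.mem_add, Multiset.mem_singleton] at hp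
    rcases hp with (hp | hp) | rfl
    · simpa [Multiset.eq_of_mem_replicate hp] using hδ.le
    · simpa [Multiset.eq_of_mem_replicate hp] using hδ.le
    · exact hxx'.le
  have hNP : N = P := IsKNN.eq_of_forall_dist_lt
    (fun p hp d hd => (hclose p hp).trans_lt (hD d hd)) (hcard ▸ hN)
  have hcount : labelCount P y' = m + 1 := by
    simp [hP, labelCount_poison, hyy']
  refine ⟨hNP, hNP ▸ hcount, fun ℓ hℓ => ?_⟩
  rw [hNP, hcount, hP, labelCount_poison, if_neg hℓ.symm]
  split_ifs <;> omega
end
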